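/- Let (a_{ij}, λ_i) satisfy a_{ij,k} = λ_i g_{jk} + λ_j g_{ik} and λ_{,ij} = μ g_{ij} + B a_{ij} on a neighborhood U (B constant, μ smooth). Then along every g-geodesic γ(t) contained in U, the function t ↦ λ(γ(t)) satisfies the ODE d³/dt³ λ(γ(t)) = 4B·g(γ'(t),γ'(t))·d/dt λ(γ(t)), where g(γ',γ') is constant along γ. -/

import Mathlib

open scoped BigOperators
noncomputable section

/-- Partial derivative of a scalar function on ℝⁿ in direction `i`. -/
def pd {n : ℕ} (i : Fin n) (f : (Fin n → ℝ) → ℝ) (x : Fin n → ℝ) : ℝ :=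
  fderiv ℝ f x (Pi.single i 1)

/-- Christoffel symbols `Γ^k_{ij}` of the Levi-Civita connection of the metric `g`
(`ginv` denotes the inverse metric). -/
def christoffel {n : ℕ} (g ginv : (Fin n → ℝ) → Fin n → Fin n → ℝ)
    (k i j : Fin n) (x : Fin n → ℝ) : ℝ :=
  (1/2) * ∑ l, ginv x k l *
    (pd i (fun y => g y l j) x + pd j (fun y => g y l i) x - pd l (fun y => g y i j) x)

/-- Covariant derivative `ω_{i,j}` of a covector field `ω`. -/
def covD1 {n : ℕ} (g ginv : (Fin n → ℝ) → Fin n → Fin n → ℝ)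
    (ω : (Fin n → ℝ) → Fin n → ℝ) (i j : Fin n) (x : Fin n → ℝ) : ℝ :=
  pd j (fun y => ω y i) x - ∑ p, christoffel g ginv p i j x * ω x p

/-- Covariant derivative `a_{ij,k}` of a symmetric (0,2)-tensor field `a`. -/
def covD2 {n : ℕ} (g ginv : (Fin n → ℝ) → Fin n → Fin n → ℝ)
    (a : (Fin n → ℝ) → Fin n → Fin n → ℝ) (i j k : Fin n) (x : Fin n → ℝ) : ℝ :=
  pd k (fun y => a y i j) x - (∑ p, christoffel g ginv p i k x * a x p j)
    - ∑ p, christoffel g ginv p j k x * a x i p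

/-- Hessian `f_{,ij}` of a function. -/
def hess {n : ℕ} (g ginv : (Fin n → ℝ) → Fin n → Fin n → ℝ)
    (f : (Fin n → ℝ) → ℝ) (i j : Fin n) (x : Fin n → ℝ) : ℝ :=
  covD1 g ginv (fun y p => pd p f y) i j x

/-- Third covariant derivative `f_{,ijk}` of a function. -/
def thirdD {n : ℕ} (g ginv : (Fin n → ℝ) → Fin n → Fin n → ℝ)
    (f : (Fin n → ℝ) → ℝ) (i j k : Fin n) (x : Fin n → ℝ) : ℝ :=
  covD2 g ginv (fun y p q => hess g ginv f p q y) i j k x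

theorem ContDiff.differentiable_of_smooth {E F : Type*} [NormedAddCommGroup E] [NormedSpace ℝ E]
    [NormedAddCommGroup F] [NormedSpace ℝ F] {f : E → F} (hf : ContDiff ℝ (⊤ : ℕ∞) f) :
    Differentiable ℝ f :=
  hf.differentiable (by simp)

section PartialDerivatives

variable {n : ℕ} {f h : (Fin n → ℝ) → ℝ}

theorem contDiff_pd (hf : ContDiff ℝ (⊤ : ℕ∞) f) (i : Fin n) :
    ContDiff ℝ (⊤ : ℕ∞) (fun x => pd i f x) := by
  unfold pd
  exact (hf.fderiv_right (m := (⊤ : ℕ∞)) (by simp)).clm_apply contDiff_const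

theorem pd_add (hf : Differentiable ℝ f) (hh : Differentiable ℝ h) (i : Fin n)
    (x : Fin n → ℝ) : pd i (fun y => f y + h y) x = pd i f x + pd i h x := by
  unfold pd
  rw [fderiv_fun_add (hf x) (hh x)]
  rfl

theorem pd_mul (hf : Differentiable ℝ f) (hh : Differentiable ℝ h) (i : Fin n)
    (x : Fin n → ℝ) :
    pd i (fun y => f y * h y) x = pd i f x * h x + f x * pd i h x := by
  unfold pd
  rw [fderiv_fun_mul (hf x) (hh x)]
  simp only [add_apply, smul_apply, smul_eq_mul]
  ring

theorem pd_const_mul (hf : Differentiable ℝ f) (c : ℝ) (i : Fin n) (x : Fin n → ℝ) :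
    pd i (fun y => c * f y) x = c * pd i f x := by
  unfold pd
  rw [fderiv_const_mul (hf x)]
  rfl

theorem pd_sum_mul {F G : Fin n → (Fin n → ℝ) → ℝ} (hF : ∀ p, Differentiable ℝ (F p))
    (hG : ∀ p, Differentiable ℝ (G p)) (i : Fin n) (x : Fin n → ℝ) :
    pd i (fun y => ∑ p, F p y * G p y) x
      = ∑ p, (pd i (F p) x * G p x + F p x * pd i (G p) x) := by
  unfold pd
  rw [fderiv_fun_sum fun p _ => ((hF p).fun_mul (hG p)) x]
  simp only [sum_apply]
  exact Finset.sum_congr rfl fun p _ => pd_mul (hF p) (hG p) i x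

theorem pd_comm (hf : ContDiff ℝ (⊤ : ℕ∞) f) (i j : Fin n) (x : Fin n → ℝ) :
    pd i (fun y => pd j f y) x = pd j (fun y => pd i f y) x := by
  have hd : DifferentiableAt ℝ (fderiv ℝ f) x :=
    ((hf.fderiv_right (m := (⊤ : ℕ∞)) (by simp)).differentiable_of_smooth) x
  have hs : IsSymmSndFDerivAt ℝ f x :=
    hf.contDiffAt.isSymmSndFDerivAt (by simpa using WithTop.coe_le_coe.2 (le_top : (2 : ℕ∞) ≤ ⊤))
  have key : ∀ u v : Fin n → ℝ,
      fderiv ℝ (fun y => fderiv ℝ f y u) x v = fderiv ℝ (fderiv ℝ f) x v u := by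
    intro u v
    rw [fderiv_clm_apply hd (differentiableAt_const u)]
    simp
  unfold pd
  rw [key, key]
  exact hs _ _

theorem pd_congr_of_eventuallyEq {x : Fin n → ℝ} (hfh : f =ᶠ[nhds x] h) (i : Fin n) :
    pd i f x = pd i h x := by
  unfold pd
  rw [hfh.fderiv_eq]

theorem hasDerivAt_comp_pd (hf : Differentiable ℝ f) {γ : ℝ → Fin n → ℝ}
    (hγ : ∀ i, ContDiff ℝ (⊤ : ℕ∞) (fun t => γ t i)) (t : ℝ) :
    HasDerivAt (fun s => f (γ s)) (∑ k, pd k f (γ t) * deriv (fun s => γ s k) t) t := by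
  have h1 : HasDerivAt γ (fun k => deriv (fun s => γ s k) t) t :=
    hasDerivAt_pi.2 fun k => ((hγ k).differentiable_of_smooth t).hasDerivAt
  have h2 := (hf (γ t)).hasFDerivAt.comp_hasDerivAt t h1
  have h3 : (fun k => deriv (fun s => γ s k) t)
      = ∑ k, deriv (fun s => γ s k) t • (Pi.single k 1 : Fin n → ℝ) := by
    ext j
    simp [Finset.sum_apply, Pi.single_apply]
  rw [h3] at h2
  simp only [map_sum, map_smul, smul_eq_mul] at h2
  simp only [pd, mul_comm _ (deriv _ _)]
  exact h2

end PartialDerivatives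

section Connection

variable {n : ℕ}

/-- Curvature components `∂_l Γ^p_{ik} - ∂_k Γ^p_{il} + Γ^p_{sl} Γ^s_{ik} - Γ^p_{sk} Γ^s_{il}`
of the connection with symbols `Γ`. -/
def curvature (Γ : Fin n → Fin n → Fin n → (Fin n → ℝ) → ℝ) (p i l k : Fin n)
    (x : Fin n → ℝ) : ℝ :=
  pd l (Γ p i k) x - pd k (Γ p i l) x + ∑ s, Γ p s l x * Γ s i k x - ∑ s, Γ p s k x * Γ s i l x

variable {Γ : Fin n → Fin n → Fin n → (Fin n → ℝ) → ℝ}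

theorem curvature_swap (p i l k : Fin n) (x : Fin n → ℝ) :
    curvature Γ p i l k x = -curvature Γ p i k l x := by
  unfold curvature
  ring

theorem curvature_bianchi (hsym : ∀ p i j, Γ p i j = Γ p j i) (p i l k : Fin n)
    (x : Fin n → ℝ) :
    curvature Γ p i l k x + curvature Γ p l k i x + curvature Γ p k i l x = 0 := by
  unfold curvature
  rw [hsym p l i, hsym p k i, hsym p k l]
  simp only [hsym _ l i, hsym _ k i, hsym _ k l]
  ring

/-- Ricci identity for a covector field with `ω_{i,k} = H_{ik}`. -/
theorem ricci_identity_covector (hΓ : ∀ p i k, Differentiable ℝ (Γ p i k))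
    {ω : Fin n → (Fin n → ℝ) → ℝ} {H : Fin n → Fin n → (Fin n → ℝ) → ℝ}
    (hω : ∀ i, ContDiff ℝ (⊤ : ℕ∞) (ω i)) (hH : ∀ i k, Differentiable ℝ (H i k))
    (hcov : ∀ i k x, pd k (ω i) x = ∑ p, Γ p i k x * ω p x + H i k x)
    (i k l : Fin n) (x : Fin n → ℝ) :
    ∑ p, curvature Γ p i l k x * ω p x
      + (∑ p, Γ p i k x * H p l x + pd l (H i k) x)
      - (∑ p, Γ p i l x * H p k x + pd k (H i l) x) = 0 := by
  have hωd : ∀ p, Differentiable ℝ (ω p) := fun p => (hω p).differentiable_of_smooth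
  have snd : ∀ k l, pd l (fun y => pd k (ω i) y) x
      = ∑ p, pd l (Γ p i k) x * ω p x + ∑ p, (∑ s, Γ p s l x * Γ s i k x) * ω p x
        + ∑ p, Γ p i k x * H p l x + pd l (H i k) x := by
    intro k l
    have swap : ∑ p, (∑ s, Γ p s l x * Γ s i k x) * ω p x
        = ∑ s, Γ s i k x * ∑ p, Γ p s l x * ω p x := by
      simp only [Finset.sum_mul, Finset.mul_sum]
      rw [Finset.sum_comm]
      exact Finset.sum_congr rfl fun _ _ => Finset.sum_congr rfl fun _ _ => by ring
    simp only [hcov i k]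
    rw [pd_add (by fun_prop) (hH i k), pd_sum_mul (fun p => hΓ p i k) hωd, swap]
    simp only [hcov, mul_add, Finset.sum_add_distrib]
    ring
  have h := pd_comm (hω i) l k x
  rw [snd, snd] at h
  simp only [curvature, add_mul, sub_mul, Finset.sum_add_distrib, Finset.sum_sub_distrib]
  linarith

/-- Ricci identity for a 2-tensor field with `T_{ij,k} = S_{ijk}`. -/
theorem ricci_identity_tensor (hΓ : ∀ p i k, Differentiable ℝ (Γ p i k))
    {T : Fin n → Fin n → (Fin n → ℝ) → ℝ} {S : Fin n → Fin n → Fin n → (Fin n → ℝ) → ℝ}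
    (hT : ∀ i j, ContDiff ℝ (⊤ : ℕ∞) (T i j)) (hS : ∀ i j k, Differentiable ℝ (S i j k))
    (hcov : ∀ i j k x, pd k (T i j) x
      = ∑ p, Γ p i k x * T p j x + ∑ p, Γ p j k x * T i p x + S i j k x)
    (i j k l : Fin n) (x : Fin n → ℝ) :
    ∑ p, curvature Γ p i l k x * T p j x + ∑ p, curvature Γ p j l k x * T i p x
      + (∑ p, Γ p i k x * S p j l x + ∑ p, Γ p j k x * S i p l x + pd l (S i j k) x)
      - (∑ p, Γ p i l x * S p j k x + ∑ p, Γ p j l x * S i p k x + pd k (S i j l) x) = 0 := by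
  have hTd : ∀ i j, Differentiable ℝ (T i j) := fun i j => (hT i j).differentiable_of_smooth
  have h := ricci_identity_covector hΓ (ω := fun i => T i j)
    (H := fun i k y => ∑ p, Γ p j k y * T i p y + S i j k y) (fun i => hT i j)
    (fun i k => by fun_prop) (fun i k x => by rw [hcov]; ring) i k l x
  have deriv_H : ∀ k l, pd l (fun y => ∑ p, Γ p j k y * T i p y + S i j k y) x
      = ∑ p, pd l (Γ p j k) x * T i p x + ∑ p, (∑ s, Γ p s l x * Γ s j k x) * T i p x
        + ∑ q, Γ q i l x * ∑ p, Γ p j k x * T q p x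
        + ∑ p, Γ p j k x * S i p l x + pd l (S i j k) x := by
    intro k l
    have swap : ∑ p, (∑ s, Γ p s l x * Γ s j k x) * T i p x
        = ∑ s, Γ s j k x * ∑ p, Γ p s l x * T i p x := by
      simp only [Finset.sum_mul, Finset.mul_sum]
      rw [Finset.sum_comm]
      exact Finset.sum_congr rfl fun _ _ => Finset.sum_congr rfl fun _ _ => by ring
    have cross : ∑ q, Γ q i l x * ∑ p, Γ p j k x * T q p x
        = ∑ p, Γ p j k x * ∑ q, Γ q i l x * T q p x := by
      simp only [Finset.mul_sum]
      rw [Finset.sum_comm]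
      exact Finset.sum_congr rfl fun _ _ => Finset.sum_congr rfl fun _ _ => by ring
    rw [pd_add (by fun_prop) (hS i j k), pd_sum_mul (fun p => hΓ p j k) (fun p => hTd i p),
      swap, cross]
    simp only [hcov, mul_add, Finset.sum_add_distrib]
    ring
  rw [deriv_H, deriv_H] at h
  have expand : ∑ p, curvature Γ p j l k x * T i p x
      = ∑ p, pd l (Γ p j k) x * T i p x - ∑ p, pd k (Γ p j l) x * T i p x
        + ∑ p, (∑ s, Γ p s l x * Γ s j k x) * T i p x
        - ∑ p, (∑ s, Γ p s k x * Γ s j l x) * T i p x := by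
    simp only [curvature, add_mul, sub_mul, Finset.sum_add_distrib, Finset.sum_sub_distrib]
  simp only [mul_add, Finset.sum_add_distrib] at h
  linarith

end Connection

section Metric

variable {n : ℕ}

theorem inverse_mul_metric {g ginv : Fin n → Fin n → ℝ}
    (hinv : ∀ i j, ∑ k, g i k * ginv k j = if i = j then (1 : ℝ) else 0) (i j : Fin n) :
    ∑ k, ginv i k * g k j = if i = j then (1 : ℝ) else 0 := by
  have h : Matrix.of g * Matrix.of ginv = 1 := by
    ext i j
    simp [Matrix.mul_apply, Matrix.one_apply, hinv]
  have h' := congrArg (fun M : Matrix (Fin n) (Fin n) ℝ => M i j) (mul_eq_one_comm.1 h)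
  simpa [Matrix.mul_apply, Matrix.one_apply] using h'

theorem raise_lower {g ginv : Fin n → Fin n → ℝ}
    (hinv : ∀ i j, ∑ k, g i k * ginv k j = if i = j then (1 : ℝ) else 0) (v : Fin n → ℝ)
    (p : Fin n) : ∑ m, ginv p m * ∑ q, g m q * v q = v p := by
  simp only [Finset.mul_sum]
  rw [Finset.sum_comm]
  simp only [← mul_assoc, ← Finset.sum_mul, inverse_mul_metric hinv]
  simp

theorem lower_raise {g ginv : Fin n → Fin n → ℝ}
    (hinv : ∀ i j, ∑ k, g i k * ginv k j = if i = j then (1 : ℝ) else 0) (v : Fin n → ℝ)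
    (p : Fin n) : ∑ m, g p m * ∑ q, ginv m q * v q = v p := by
  simp only [Finset.mul_sum]
  rw [Finset.sum_comm]
  simp only [← mul_assoc, ← Finset.sum_mul, hinv]
  simp

variable {g ginv : (Fin n → ℝ) → Fin n → Fin n → ℝ}

theorem christoffel_symm (hsym : ∀ x i j, g x i j = g x j i) (k i j : Fin n) :
    christoffel g ginv k i j = christoffel g ginv k j i := by
  ext x
  unfold christoffel
  simp only [hsym _ i j]
  congr 1
  exact Finset.sum_congr rfl fun _ _ => by ring

theorem contDiff_christoffel (hg : ∀ i j, ContDiff ℝ (⊤ : ℕ∞) (fun x => g x i j))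
    (hginv : ∀ i j, ContDiff ℝ (⊤ : ℕ∞) (fun x => ginv x i j)) (k i j : Fin n) :
    ContDiff ℝ (⊤ : ℕ∞) (christoffel g ginv k i j) := by
  unfold christoffel
  exact contDiff_const.mul (ContDiff.sum fun l _ => (hginv k l).mul
    (((contDiff_pd (hg l j) i).add (contDiff_pd (hg l i) j)).sub (contDiff_pd (hg i j) l)))

theorem lower_christoffel
    (hinv : ∀ x i j, (∑ k, g x i k * ginv x k j) = if i = j then (1 : ℝ) else 0)
    (l i j : Fin n) (x : Fin n → ℝ) :
    ∑ p, g x l p * christoffel g ginv p i j x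
      = (1 / 2) * (pd i (fun y => g y l j) x + pd j (fun y => g y l i) x
          - pd l (fun y => g y i j) x) := by
  unfold christoffel
  simp only [mul_left_comm _ (1 / 2 : ℝ), ← Finset.mul_sum]
  rw [lower_raise (hinv x)]

theorem pd_metric (hsym : ∀ x i j, g x i j = g x j i)
    (hinv : ∀ x i j, (∑ k, g x i k * ginv x k j) = if i = j then (1 : ℝ) else 0)
    (i j k : Fin n) (x : Fin n → ℝ) :
    pd k (fun y => g y i j) x = ∑ p, christoffel g ginv p i k x * g x p j
      + ∑ p, christoffel g ginv p j k x * g x i p := by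
  have h1 := lower_christoffel hinv j i k x
  have h2 := lower_christoffel hinv i j k x
  simp only [hsym _ j i] at h1
  simp only [hsym x _ j, mul_comm (christoffel _ _ _ _ _ _)]
  rw [h1, h2]
  ring

theorem covD2_metric (hsym : ∀ x i j, g x i j = g x j i)
    (hinv : ∀ x i j, (∑ k, g x i k * ginv x k j) = if i = j then (1 : ℝ) else 0)
    (i j k : Fin n) (x : Fin n → ℝ) : covD2 g ginv g i j k x = 0 := by
  unfold covD2
  rw [pd_metric hsym hinv]
  ring

/-- Pair symmetry of a tensor with the symmetries of the Riemann tensor. -/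
theorem pair_symmetry {W : Fin n → Fin n → Fin n → Fin n → ℝ}
    (h1 : ∀ m i l k, W m i l k = -W i m l k) (h2 : ∀ m i l k, W m i l k = -W m i k l)
    (hb : ∀ m i l k, W m i l k + W m l k i + W m k i l = 0) (m i l k : Fin n) :
    W m i l k = W l k m i := by
  linarith [hb m i l k, hb i l k m, hb l k m i, hb k m i l, h1 m i l k, h1 m l k i, h1 m k i l,
    h1 i l k m, h1 i k m l, h1 l k m i, h2 m i l k, h2 m l k i, h2 m k i l, h2 i l k m, h2 i k m l,
    h2 l k m i, h2 i m l k, h2 l m i k, h2 l i k m, h2 k l m i, h2 k m i l, h2 k i l m]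

/-- The algebraic consequence of the integrability conditions for `L` and `a`. -/
theorem symmetrized_of_integrability {g ginv a : Fin n → Fin n → ℝ}
    {R : Fin n → Fin n → Fin n → Fin n → ℝ} {L κ : Fin n → ℝ} {B : ℝ}
    (hsym : ∀ i j, g i j = g j i)
    (hinv : ∀ i j, ∑ k, g i k * ginv k j = if i = j then (1 : ℝ) else 0)
    (hasym : ∀ i j, a i j = a j i)
    (hswap : ∀ p i l k, R p i l k = -R p i k l)
    (hbianchi : ∀ p i l k, R p i l k + R p l k i + R p k i l = 0)
    (hg : ∀ i j l k, ∑ p, R p i l k * g p j + ∑ p, R p j l k * g i p = 0)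
    (hL : ∀ i l k, ∑ p, R p i l k * L p = κ k * g i l - κ l * g i k)
    (ha : ∀ i j l k, ∑ p, R p i l k * a p j + ∑ p, R p j l k * a i p
      = -(B * (a i l * g j k + a j l * g i k - a i k * g j l - a j k * g i l)))
    (i j k : Fin n) :
    (κ i - B * L i) * a k j + (κ j - B * L j) * a k i
      = g k i * ∑ p, (∑ m, ginv p m * (κ m - B * L m)) * a p j
        + g k j * ∑ p, (∑ m, ginv p m * (κ m - B * L m)) * a p i := by
  set v : Fin n → ℝ := fun l => ∑ m, ginv l m * L m with hv
  have lower_v : ∀ q, ∑ l, v l * g q l = L q := fun q => by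
    simpa only [hv, mul_comm (g q _)] using lower_raise hinv L q
  set W : Fin n → Fin n → Fin n → Fin n → ℝ := fun m i l k => ∑ p, g m p * R p i l k with hW
  have hpair : ∀ m i l k, W m i l k = W l k m i := by
    refine pair_symmetry (fun m i l k => ?_) (fun m i l k => ?_) (fun m i l k => ?_)
    · have h := hg i m l k
      simp only [hW, mul_comm (g _ _)]
      simp only [hsym _ m] at h
      linarith
    · simp only [hW, ← Finset.sum_neg_distrib, ← mul_neg, ← hswap]
    · simp only [hW, ← Finset.sum_add_distrib, ← mul_add, hbianchi]
      simp
  have contract_W : ∀ i m k, ∑ l, v l * W l k m i = κ i * g k m - κ m * g k i := by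
    intro i m k
    rw [← hL]
    simp only [hW, Finset.mul_sum]
    rw [Finset.sum_comm]
    refine Finset.sum_congr rfl fun p _ => ?_
    rw [← lower_v p, Finset.mul_sum]
    exact Finset.sum_congr rfl fun l _ => by rw [hsym p l]; ring
  have contract_R : ∀ p i k, ∑ l, v l * R p i l k
      = κ i * (if p = k then 1 else 0) - (∑ m, ginv p m * κ m) * g k i := by
    intro p i k
    have h : ∀ l, R p i l k = ∑ m, ginv p m * W l k m i := fun l => by
      simp only [hpair l k]
      exact (raise_lower hinv (fun q => R q i l k) p).symm
    simp only [h, Finset.mul_sum]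
    rw [Finset.sum_comm]
    rw [← inverse_mul_metric hinv, Finset.mul_sum, Finset.sum_mul, ← Finset.sum_sub_distrib]
    refine Finset.sum_congr rfl fun m _ => ?_
    simp only [mul_left_comm (v _), ← Finset.mul_sum]
    rw [contract_W, hsym k m]
    ring
  have contract_Ra : ∀ i j, ∑ l, v l * ∑ p, R p i l k * a p j
      = κ i * a k j - g k i * ∑ p, (∑ m, ginv p m * κ m) * a p j := by
    intro i j
    simp only [Finset.mul_sum]
    rw [Finset.sum_comm]
    simp only [← mul_assoc, ← Finset.sum_mul, contract_R, sub_mul, Finset.sum_sub_distrib]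
    congr 1
    · simp
    · rw [Finset.sum_congr rfl]
      intro p _
      rw [Finset.mul_sum]
      simp only [mul_comm (g k i), Finset.sum_mul]
  have contract_a := calc
    ∑ l, v l * ∑ p, R p i l k * a p j + ∑ l, v l * ∑ p, R p j l k * a p i
        = ∑ l, v l * (∑ p, R p i l k * a p j + ∑ p, R p j l k * a i p) := by
          simp only [hasym i, mul_add, Finset.sum_add_distrib]
    _ = -(B * ((∑ l, v l * a l i) * g k j + (∑ l, v l * a l j) * g k i
          - a k i * L j - a k j * L i)) := by
          simp only [ha]
          rw [← lower_v i, ← lower_v j]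
          simp only [Finset.mul_sum, Finset.sum_mul, ← Finset.sum_add_distrib,
            ← Finset.sum_sub_distrib, ← Finset.sum_neg_distrib]
          refine Finset.sum_congr rfl fun l _ => ?_
          rw [hasym l i, hasym l j, hasym k i, hasym k j, hsym k i, hsym k j]
          ring
  rw [contract_Ra, contract_Ra] at contract_a
  have split : ∀ j, ∑ p, (∑ m, ginv p m * (κ m - B * L m)) * a p j
      = ∑ p, (∑ m, ginv p m * κ m) * a p j - B * ∑ l, v l * a l j := by
    intro j
    rw [Finset.mul_sum, ← Finset.sum_sub_distrib]
    refine Finset.sum_congr rfl fun p _ => ?_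
    simp only [hv, mul_sub, Finset.sum_sub_distrib, mul_left_comm (ginv _ _) B,
      ← Finset.mul_sum]
    ring
  rw [split, split]
  linear_combination contract_a

/-- If `ν ≠ 0`, the symmetrized relation forces `a` to be its trace part. -/
theorem eq_trace_of_symmetrized {g ginv a : Fin n → Fin n → ℝ} {ν : Fin n → ℝ}
    (hsym : ∀ i j, g i j = g j i)
    (hinv : ∀ i j, ∑ k, g i k * ginv k j = if i = j then (1 : ℝ) else 0)
    (hn : n ≠ 0)
    (h : ∀ i j k, ν i * a k j + ν j * a k i
      = g k i * ∑ p, (∑ m, ginv p m * ν m) * a p j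
        + g k j * ∑ p, (∑ m, ginv p m * ν m) * a p i)
    {m : Fin n} (hm : ν m ≠ 0) (i j : Fin n) :
    a i j = (∑ p, ∑ q, ginv p q * a p q) / n * g i j := by
  set w : Fin n → ℝ := fun j => ∑ p, (∑ m, ginv p m * ν m) * a p j with hw
  set τ : ℝ := ∑ p, ∑ q, ginv p q * a p q with hτ
  have hn' : (n : ℝ) ≠ 0 := Nat.cast_ne_zero.2 hn
  have trace : ∀ i, (n : ℝ) * w i = τ * ν i := by
    intro i
    have h1 : ∑ k, ∑ j, ginv k j * (ν i * a k j + ν j * a k i) = τ * ν i + w i := by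
      simp only [mul_add, Finset.sum_add_distrib]
      congr 1
      · simp only [hτ, Finset.sum_mul]
        exact Finset.sum_congr rfl fun _ _ => Finset.sum_congr rfl fun _ _ => by ring
      · simp only [hw, Finset.sum_mul]
        exact Finset.sum_congr rfl fun _ _ => Finset.sum_congr rfl fun _ _ => by ring
    have h2 : ∑ k, ∑ j, ginv k j * (g k i * w j + g k j * w i) = w i + n * w i := by
      simp only [mul_add, Finset.sum_add_distrib]
      congr 1
      · have h3 := lower_raise hinv w i
        rw [← h3]
        simp only [Finset.mul_sum]
        exact Finset.sum_congr rfl fun k _ => Finset.sum_congr rfl fun _ _ => by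
          rw [hsym i k]; ring
      · simp only [← mul_assoc, ← Finset.sum_mul]
        congr 1
        have h3 : ∀ k, ∑ j, ginv k j * g k j = 1 := fun k => by
          simpa [hsym k] using inverse_mul_metric hinv k k
        simp [h3]
    have h3 : ∑ k, ∑ j, ginv k j * (ν i * a k j + ν j * a k i)
        = ∑ k, ∑ j, ginv k j * (g k i * w j + g k j * w i) :=
      Finset.sum_congr rfl fun k _ => Finset.sum_congr rfl fun j _ => by rw [h i j k]
    linarith
  have hw' : ∀ i, w i = τ / n * ν i := fun i => by
    field_simp
    linarith [trace i]
  have tracefree : ∀ i j k, ν i * (a k j - τ / n * g k j) + ν j * (a k i - τ / n * g k i) = 0 := by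
    intro i j k
    have h1 := h i j k
    change _ = g k i * w j + g k j * w i at h1
    rw [hw', hw'] at h1
    linear_combination h1
  have col : ∀ k, a k m - τ / n * g k m = 0 := fun k =>
    (mul_eq_zero.1 (by linarith [tracefree m m k] : ν m * (a k m - τ / n * g k m) = 0)).resolve_left
      hm
  have h1 := tracefree m j i
  rw [col, mul_zero, add_zero] at h1
  exact sub_eq_zero.1 ((mul_eq_zero.1 h1).resolve_left hm)

end Metric

section Geodesic

variable {n : ℕ} {g ginv : (Fin n → ℝ) → Fin n → Fin n → ℝ} {γ : ℝ → Fin n → ℝ}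

theorem sum_quadratic_mul (G : Fin n → Fin n → Fin n → ℝ) (v q : Fin n → ℝ) :
    ∑ p, q p * ∑ i, ∑ k, G p i k * v i * v k
      = ∑ i, ∑ k, (∑ p, G p i k * q p) * v i * v k := by
  simp only [Finset.mul_sum, Finset.sum_mul]
  rw [Finset.sum_comm]
  refine Finset.sum_congr rfl fun i _ => ?_
  rw [Finset.sum_comm]
  exact Finset.sum_congr rfl fun k _ => Finset.sum_congr rfl fun p _ => by ring

theorem hasDerivAt_velocity (hγ : ∀ i, ContDiff ℝ (⊤ : ℕ∞) (fun t => γ t i))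
    (hgeo : ∀ t k, deriv (deriv (fun s => γ s k)) t
      + ∑ i, ∑ j, christoffel g ginv k i j (γ t)
          * deriv (fun s => γ s i) t * deriv (fun s => γ s j) t = 0) (k : Fin n) (t : ℝ) :
    HasDerivAt (fun s => deriv (fun s => γ s k) s)
      (-∑ i, ∑ j, christoffel g ginv k i j (γ t)
          * deriv (fun s => γ s i) t * deriv (fun s => γ s j) t) t := by
  have h1 : ContDiff ℝ (⊤ : ℕ∞) (deriv fun s => γ s k) :=
    (contDiff_infty_iff_deriv.1 (hγ k)).2
  rw [← eq_neg_of_add_eq_zero_left (hgeo t k)]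
  exact (h1.differentiable_of_smooth t).hasDerivAt

/-- Along a geodesic with velocity `v`, `d/dt ω(v) = (∇_v ω)(v)`. -/
theorem hasDerivAt_covector_geodesic (hγ : ∀ i, ContDiff ℝ (⊤ : ℕ∞) (fun t => γ t i))
    (hgeo : ∀ t k, deriv (deriv (fun s => γ s k)) t
      + ∑ i, ∑ j, christoffel g ginv k i j (γ t)
          * deriv (fun s => γ s i) t * deriv (fun s => γ s j) t = 0)
    {ω : (Fin n → ℝ) → Fin n → ℝ} (hω : ∀ i, Differentiable ℝ (fun x => ω x i)) (t : ℝ) :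
    HasDerivAt (fun s => ∑ i, ω (γ s) i * deriv (fun u => γ u i) s)
      (∑ i, ∑ j, covD1 g ginv ω i j (γ t)
        * deriv (fun s => γ s i) t * deriv (fun s => γ s j) t) t := by
  refine (HasDerivAt.fun_sum fun i _ => (hasDerivAt_comp_pd (hω i) hγ t).mul
    (hasDerivAt_velocity hγ hgeo i t)).congr_deriv ?_
  simp only [mul_neg, Finset.sum_add_distrib, Finset.sum_neg_distrib, covD1, sub_mul,
    Finset.sum_sub_distrib]
  rw [sum_quadratic_mul (fun p i j => christoffel g ginv p i j (γ t)), ← sub_eq_add_neg]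
  congr 1
  refine Finset.sum_congr rfl fun i _ => ?_
  rw [Finset.sum_mul]
  exact Finset.sum_congr rfl fun j _ => by ring

/-- Along a geodesic with velocity `v`, `d/dt T(v, v) = (∇_v T)(v, v)`. -/
theorem hasDerivAt_tensor_geodesic (hγ : ∀ i, ContDiff ℝ (⊤ : ℕ∞) (fun t => γ t i))
    (hgeo : ∀ t k, deriv (deriv (fun s => γ s k)) t
      + ∑ i, ∑ j, christoffel g ginv k i j (γ t)
          * deriv (fun s => γ s i) t * deriv (fun s => γ s j) t = 0)
    {T : (Fin n → ℝ) → Fin n → Fin n → ℝ} (hT : ∀ i j, Differentiable ℝ (fun x => T x i j))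
    (t : ℝ) :
    HasDerivAt (fun s => ∑ i, ∑ j, T (γ s) i j * deriv (fun u => γ u i) s
        * deriv (fun u => γ u j) s)
      (∑ i, ∑ j, ∑ k, covD2 g ginv T i j k (γ t) * deriv (fun s => γ s i) t
        * deriv (fun s => γ s j) t * deriv (fun s => γ s k) t) t := by
  refine (HasDerivAt.fun_sum fun i _ => HasDerivAt.fun_sum fun j _ =>
    ((hasDerivAt_comp_pd (hT i j) hγ t).fun_mul (hasDerivAt_velocity hγ hgeo i t)).fun_mul
      (hasDerivAt_velocity hγ hgeo j t)).congr_deriv ?_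
  set v : Fin n → ℝ := fun i => deriv (fun s => γ s i) t with hv
  set G : Fin n → Fin n → Fin n → ℝ := fun p i j => christoffel g ginv p i j (γ t) with hG
  have first : ∑ i, ∑ j, T (γ t) i j * (∑ k, ∑ l, G i k l * v k * v l) * v j
      = ∑ i, ∑ j, ∑ k, (∑ p, G p i k * T (γ t) p j) * v i * v j * v k := by
    have h := sum_quadratic_mul G v (fun p => ∑ j, T (γ t) p j * v j)
    calc _ = ∑ p, (∑ j, T (γ t) p j * v j) * ∑ i, ∑ k, G p i k * v i * v k := by
          refine Finset.sum_congr rfl fun p _ => ?_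
          rw [Finset.sum_mul]
          exact Finset.sum_congr rfl fun j _ => by ring
      _ = _ := by
          rw [h]
          refine Finset.sum_congr rfl fun i _ => ?_
          rw [Finset.sum_comm]
          refine Finset.sum_congr rfl fun k _ => ?_
          simp only [Finset.mul_sum, Finset.sum_mul]
          rw [Finset.sum_comm]
          exact Finset.sum_congr rfl fun j _ => Finset.sum_congr rfl fun p _ => by ring
  have second : ∑ i, ∑ j, T (γ t) i j * v i * (∑ k, ∑ l, G j k l * v k * v l)
      = ∑ i, ∑ j, ∑ k, (∑ p, G p j k * T (γ t) i p) * v i * v j * v k := by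
    refine Finset.sum_congr rfl fun i _ => ?_
    rw [sum_quadratic_mul G v (fun p => T (γ t) i p * v i)]
    refine Finset.sum_congr rfl fun j _ => Finset.sum_congr rfl fun k _ => ?_
    simp only [Finset.sum_mul]
    exact Finset.sum_congr rfl fun p _ => by ring
  have third : ∑ i, ∑ j, (∑ k, pd k (fun x => T x i j) (γ t) * v k) * v i * v j
      = ∑ i, ∑ j, ∑ k, pd k (fun x => T x i j) (γ t) * v i * v j * v k := by
    simp only [Finset.sum_mul]
    exact Finset.sum_congr rfl fun i _ => Finset.sum_congr rfl fun j _ =>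
      Finset.sum_congr rfl fun k _ => by ring
  simp only [covD2, sub_mul, Finset.sum_sub_distrib]
  rw [← first, ← second, ← third]
  simp only [← Finset.sum_sub_distrib]
  exact Finset.sum_congr rfl fun i _ => Finset.sum_congr rfl fun j _ => by simp only [hv, hG]; ring

end Geodesic

section Sinjukov

variable {n : ℕ} {g ginv a : (Fin n → ℝ) → Fin n → Fin n → ℝ} {μ lam : (Fin n → ℝ) → ℝ} {B : ℝ}

/-- A solution that is pure trace near `x` has critical `lam` at `x`. -/
theorem pd_eq_zero_of_eventually_trace (hn : 2 ≤ n)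
    (hgC : ∀ i j, Differentiable ℝ (fun x => g x i j)) (hlamC : Differentiable ℝ lam)
    (hgsym : ∀ x i j, g x i j = g x j i)
    (hinv : ∀ x i j, (∑ k, g x i k * ginv x k j) = if i = j then (1 : ℝ) else 0)
    (ha : ∀ x i j k, covD2 g ginv a i j k x = pd i lam x * g x j k + pd j lam x * g x i k)
    {x : Fin n → ℝ} (htr : ∀ᶠ y in nhds x, ∀ i j, a y i j = 2 / n * (lam y * g y i j))
    (i : Fin n) : pd i lam x = 0 := by
  have hcov : ∀ i j k, covD2 g ginv a i j k x = 2 / n * (pd k lam x * g x i j) := by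
    intro i j k
    have h1 : pd k (fun y => a y i j) x = pd k (fun y => 2 / n * (lam y * g y i j)) x :=
      pd_congr_of_eventuallyEq (htr.mono fun y hy => hy i j) k
    rw [pd_const_mul (hlamC.fun_mul (hgC i j)), pd_mul hlamC (hgC i j), pd_metric hgsym hinv] at h1
    unfold covD2
    rw [h1]
    simp only [htr.self_of_nhds, mul_left_comm (christoffel _ _ _ _ _ _), ← Finset.mul_sum]
    ring
  have h : ∀ j k, 2 / n * (pd k lam x * g x i j) = pd i lam x * g x j k + pd j lam x * g x i k :=
    fun j k => by rw [← hcov, ha]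
  have contract : ∑ j, ∑ k, ginv x j k * (2 / n * (pd k lam x * g x i j))
      = ∑ j, ∑ k, ginv x j k * (pd i lam x * g x j k + pd j lam x * g x i k) := by
    simp only [h]
  have lhs : ∑ j, ∑ k, ginv x j k * (2 / n * (pd k lam x * g x i j)) = 2 / n * pd i lam x := by
    rw [← lower_raise (hinv x) (fun k => pd k lam x) i]
    simp only [Finset.mul_sum]
    exact Finset.sum_congr rfl fun j _ => Finset.sum_congr rfl fun k _ => by ring
  have rhs : ∑ j, ∑ k, ginv x j k * (pd i lam x * g x j k + pd j lam x * g x i k)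
      = n * pd i lam x + pd i lam x := by
    simp only [mul_add, Finset.sum_add_distrib]
    congr 1
    · have h3 : ∀ j, ∑ k, ginv x j k * (pd i lam x * g x j k) = pd i lam x := fun j => by
        simp only [mul_left_comm _ (pd i lam x), ← Finset.mul_sum, hgsym x j]
        rw [inverse_mul_metric (hinv x)]
        simp
      simp [h3]
    · simp only [mul_left_comm _ (pd _ lam x), ← Finset.mul_sum, hgsym x i,
        inverse_mul_metric (hinv x)]
      simp
  rw [lhs, rhs] at contract
  have hn' : (2 : ℝ) ≤ n := by exact_mod_cast hn
  have hle : 2 / (n : ℝ) ≤ 1 := (div_le_one (by linarith)).2 hn'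
  have h0 : ((n : ℝ) + 1 - 2 / n) * pd i lam x = 0 := by linarith
  exact (mul_eq_zero.1 h0).resolve_left (by linarith)

/-- The coefficient `μ` in `λ_{,ij} = μ g_{ij} + B a_{ij}` satisfies `μ_{,k} = 2 B λ_{,k}`. -/
theorem pd_hessian_coefficient (hn : 2 ≤ n)
    (hgC : ∀ i j, ContDiff ℝ (⊤ : ℕ∞) (fun x => g x i j))
    (hginvC : ∀ i j, ContDiff ℝ (⊤ : ℕ∞) (fun x => ginv x i j))
    (haC : ∀ i j, ContDiff ℝ (⊤ : ℕ∞) (fun x => a x i j))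
    (hμC : ContDiff ℝ (⊤ : ℕ∞) μ) (hlamC : ContDiff ℝ (⊤ : ℕ∞) lam)
    (hgsym : ∀ x i j, g x i j = g x j i)
    (hinv : ∀ x i j, (∑ k, g x i k * ginv x k j) = if i = j then (1 : ℝ) else 0)
    (hasym : ∀ x i j, a x i j = a x j i)
    (hlam : ∀ x, lam x = (1 / 2) * ∑ p, ∑ q, ginv x p q * a x p q)
    (ha : ∀ x i j k, covD2 g ginv a i j k x = pd i lam x * g x j k + pd j lam x * g x i k)
    (hhess : ∀ x i j, hess g ginv lam i j x = μ x * g x i j + B * a x i j)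
    (x : Fin n → ℝ) (k : Fin n) : pd k μ x = 2 * B * pd k lam x := by
  have hgd := fun i j => (hgC i j).differentiable_of_smooth
  have had := fun i j => (haC i j).differentiable_of_smooth
  have hμd := hμC.differentiable_of_smooth
  have hlamd := hlamC.differentiable_of_smooth
  have hpdC := contDiff_pd hlamC
  have hpdd := fun i => (hpdC i).differentiable_of_smooth
  set Γ := christoffel g ginv with hΓ
  have hΓd : ∀ p i k, Differentiable ℝ (Γ p i k) := fun p i k =>
    (contDiff_christoffel hgC hginvC p i k).differentiable_of_smooth
  have hΓsym : ∀ p i j, Γ p i j = Γ p j i := christoffel_symm hgsym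
  have pd_g : ∀ i j k x, pd k (fun y => g y i j) x
      = ∑ p, Γ p i k x * g x p j + ∑ p, Γ p j k x * g x p i := fun i j k x => by
    rw [pd_metric hgsym hinv]
    simp only [hgsym x i]
    rfl
  have pd_a : ∀ i j k x, pd k (fun y => a y i j) x
      = ∑ p, Γ p i k x * a x p j + ∑ p, Γ p j k x * a x i p
        + (pd i lam x * g x j k + pd j lam x * g x i k) := fun i j k x => by
    rw [← ha, covD2]
    ring
  have pd_pd : ∀ i k x, pd k (fun y => pd i lam y) x
      = ∑ p, Γ p i k x * pd p lam x + (μ x * g x i k + B * a x i k) := fun i k x => by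
    rw [← hhess, hess, covD1]
    ring
  have ricci_g : ∀ x i j l k, ∑ p, curvature Γ p i l k x * g x p j
      + ∑ p, curvature Γ p j l k x * g x i p = 0 := by
    intro x i j l k
    have h := ricci_identity_tensor hΓd (T := fun i j y => g y i j) (S := fun _ _ _ _ => 0) hgC
      (fun _ _ _ => differentiable_const 0)
      (fun i j k x => by rw [pd_metric hgsym hinv, add_zero]) i j k l x
    simpa [pd] using h
  have ricci_lam : ∀ x i l k, ∑ p, curvature Γ p i l k x * pd p lam x
      = (pd k μ x - B * pd k lam x) * g x i l - (pd l μ x - B * pd l lam x) * g x i k := by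
    intro x i l k
    have h := ricci_identity_covector hΓd (ω := fun i y => pd i lam y)
      (H := fun i k y => μ y * g y i k + B * a y i k) hpdC
      (fun i k => by fun_prop) pd_pd i k l x
    have expand : ∀ k l, ∑ p, Γ p i k x * (μ x * g x p l + B * a x p l)
        = μ x * ∑ p, Γ p i k x * g x p l + B * ∑ p, Γ p i k x * a x p l := by
      intro k l
      simp only [mul_add, Finset.sum_add_distrib, Finset.mul_sum, mul_left_comm (Γ _ _ _ _)]
    have deriv_H : ∀ k l, pd l (fun y => μ y * g y i k + B * a y i k) x
        = pd l μ x * g x i k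
          + μ x * (∑ p, Γ p i l x * g x p k + ∑ p, Γ p k l x * g x p i)
          + B * (∑ p, Γ p i l x * a x p k + ∑ p, Γ p k l x * a x i p
            + (pd i lam x * g x k l + pd k lam x * g x i l)) := by
      intro k l
      rw [pd_add (hμd.fun_mul (hgd i k)) ((had i k).const_mul B), pd_mul hμd (hgd i k),
        pd_const_mul (had i k), pd_g, pd_a]
    simp only [expand, deriv_H, hΓsym _ l k, hgsym x l k] at h
    linear_combination h
  have ricci_a : ∀ x i j l k, ∑ p, curvature Γ p i l k x * a x p j
      + ∑ p, curvature Γ p j l k x * a x i p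
      = -(B * (a x i l * g x j k + a x j l * g x i k - a x i k * g x j l - a x j k * g x i l)) := by
    intro x i j l k
    have h := ricci_identity_tensor hΓd (T := fun i j y => a y i j)
      (S := fun i j k y => pd i lam y * g y j k + pd j lam y * g y i k) haC
      (fun _ _ _ => by fun_prop) pd_a i j k l x
    have expand_left : ∀ i j k l, ∑ p, Γ p i k x * (pd p lam x * g x j l + pd j lam x * g x p l)
        = (∑ p, Γ p i k x * pd p lam x) * g x j l
          + pd j lam x * ∑ p, Γ p i k x * g x p l := by
      intro i j k l
      simp only [mul_add, Finset.sum_add_distrib, Finset.mul_sum, Finset.sum_mul,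
        mul_left_comm (Γ _ _ _ _), mul_assoc]
    have expand_right : ∀ i j k l, ∑ p, Γ p j k x * (pd i lam x * g x p l + pd p lam x * g x i l)
        = (∑ p, Γ p j k x * pd p lam x) * g x i l
          + pd i lam x * ∑ p, Γ p j k x * g x p l := by
      intro i j k l
      rw [← expand_left]
      exact Finset.sum_congr rfl fun p _ => by ring
    have deriv_S : ∀ k l, pd l (fun y => pd i lam y * g y j k + pd j lam y * g y i k) x
        = (∑ p, Γ p i l x * pd p lam x + (μ x * g x i l + B * a x i l)) * g x j k
          + pd i lam x * (∑ p, Γ p j l x * g x p k + ∑ p, Γ p k l x * g x p j)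
          + ((∑ p, Γ p j l x * pd p lam x + (μ x * g x j l + B * a x j l)) * g x i k
          + pd j lam x * (∑ p, Γ p i l x * g x p k + ∑ p, Γ p k l x * g x p i)) := by
      intro k l
      rw [pd_add ((hpdd i).fun_mul (hgd j k)) ((hpdd j).fun_mul (hgd i k)),
        pd_mul (hpdd i) (hgd j k), pd_mul (hpdd j) (hgd i k), pd_g, pd_g, pd_pd, pd_pd]
    simp only [expand_left, expand_right, deriv_S, hΓsym _ l k] at h
    linear_combination h
  have trace_of_ne : ∀ y, pd k μ y ≠ 2 * B * pd k lam y →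
      ∀ i j, a y i j = 2 / n * (lam y * g y i j) := by
    intro y hy i j
    have h := eq_trace_of_symmetrized (ν := fun i => pd i μ y - B * pd i lam y - B * pd i lam y)
      (hgsym y) (hinv y) (by omega)
      (symmetrized_of_integrability (hgsym y) (hinv y) (hasym y)
        (fun p i l k => curvature_swap p i l k y)
        (fun p i l k => curvature_bianchi hΓsym p i l k y) (ricci_g y) (ricci_lam y) (ricci_a y))
      (m := k) (fun h0 => hy (by linear_combination h0)) i j
    rw [h, hlam y]
    ring
  by_contra hx
  have hcont : IsOpen {y | pd k μ y ≠ 2 * B * pd k lam y} :=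
    isOpen_ne_fun (contDiff_pd hμC k).continuous
      (continuous_const.mul (contDiff_pd hlamC k).continuous)
  have near : ∀ᶠ y in nhds x, pd k μ y ≠ 2 * B * pd k lam y := hcont.mem_nhds hx
  have critical : ∀ᶠ y in nhds x, ∀ i, pd i lam y = 0 :=
    near.eventually_nhds.mono fun y hy i =>
      pd_eq_zero_of_eventually_trace hn hgd hlamd hgsym hinv ha (hy.mono trace_of_ne) i
  have hμ : ∀ᶠ y in nhds x, μ y = -(2 * B / n) * lam y := by
    filter_upwards [near, critical.eventually_nhds] with y hy hcrit
    have hzero : ∀ i j, (μ y + 2 * B / n * lam y) * g y i j = 0 := by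
      intro i j
      have h1 := pd_pd i j y
      have h2 : pd j (fun z => pd i lam z) y = pd j (fun _ => 0) y :=
        pd_congr_of_eventuallyEq (hcrit.mono fun z hz => hz i) j
      rw [h2, trace_of_ne y hy] at h1
      simp only [hcrit.self_of_nhds, mul_zero, Finset.sum_const_zero] at h1
      simp only [pd, fderiv_fun_const] at h1
      simp only [Pi.zero_apply, zero_apply] at h1
      linear_combination -h1
    have hsum : ∑ j, (μ y + 2 * B / n * lam y) * g y k j * ginv y j k = 0 := by simp [hzero]
    simp only [mul_assoc (μ y + _), ← Finset.mul_sum, hinv] at hsum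
    simp only [if_true, mul_one] at hsum
    linarith
  have h1 : pd k μ x = _ := pd_congr_of_eventuallyEq hμ k
  rw [pd_const_mul hlamd, critical.self_of_nhds k] at h1
  exact hx (by rw [h1, critical.self_of_nhds k]; ring)

end Sinjukov

/-- Corollary 2 of the paper: if `(a, λ)` satisfies the Sinjukov equation and the
Hessian equation `λ_{,ij} = μ g_{ij} + B a_{ij}` (with `B` constant, `μ` smooth),
then along every affinely parametrized `g`-geodesic `γ` the function `λ∘γ` satisfies
`d³/dt³ λ(γ(t)) = 4B·g(γ'(t),γ'(t))·d/dt λ(γ(t))`, where `g(γ',γ')` is constant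
along `γ`. -/
theorem stmt_17 {n : ℕ} (hn : 2 ≤ n)
    (g ginv a : (Fin n → ℝ) → Fin n → Fin n → ℝ)
    (μ lam : (Fin n → ℝ) → ℝ) (B : ℝ)
    (hgC : ∀ i j, ContDiff ℝ (⊤ : ℕ∞) (fun x => g x i j))
    (hginvC : ∀ i j, ContDiff ℝ (⊤ : ℕ∞) (fun x => ginv x i j))
    (haC : ∀ i j, ContDiff ℝ (⊤ : ℕ∞) (fun x => a x i j))
    (hμC : ContDiff ℝ (⊤ : ℕ∞) μ)
    (hgsym : ∀ x i j, g x i j = g x j i)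
    (hinv : ∀ x i j, (∑ k, g x i k * ginv x k j) = if i = j then (1:ℝ) else 0)
    (hasym : ∀ x i j, a x i j = a x j i)
    (hlam : ∀ x, lam x = (1/2) * ∑ p, ∑ q, ginv x p q * a x p q)
    (ha : ∀ x i j k, covD2 g ginv a i j k x
      = pd i lam x * g x j k + pd j lam x * g x i k)
    (hhess : ∀ x i j, hess g ginv lam i j x = μ x * g x i j + B * a x i j)
    (γ : ℝ → Fin n → ℝ)
    (hγC : ∀ i, ContDiff ℝ (⊤ : ℕ∞) (fun t => γ t i))
    -- `γ` is an affinely parametrized geodesic of `g`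
    (hgeo : ∀ t k, deriv (deriv (fun s => γ s k)) t
      + ∑ i, ∑ j, christoffel g ginv k i j (γ t)
          * deriv (fun s => γ s i) t * deriv (fun s => γ s j) t = 0) :
    (∀ t, deriv (deriv (deriv (fun s => lam (γ s)))) t
      = 4 * B * (∑ i, ∑ j, g (γ t) i j
            * deriv (fun s => γ s i) t * deriv (fun s => γ s j) t)
        * deriv (fun s => lam (γ s)) t) ∧
    (∀ t s, (∑ i, ∑ j, g (γ t) i j
          * deriv (fun u => γ u i) t * deriv (fun u => γ u j) t)
      = ∑ i, ∑ j, g (γ s) i j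
          * deriv (fun u => γ u i) s * deriv (fun u => γ u j) s) := by
  have hlamC : ContDiff ℝ (⊤ : ℕ∞) lam := by
    rw [funext hlam]
    exact contDiff_const.mul (ContDiff.sum fun p _ => ContDiff.sum fun q _ =>
      (hginvC p q).mul (haC p q))
  have hlamd := hlamC.differentiable_of_smooth
  have energy : ∀ t, HasDerivAt (fun s => ∑ i, ∑ j, g (γ s) i j
      * deriv (fun u => γ u i) s * deriv (fun u => γ u j) s) 0 t := fun t => by
    simpa [covD2_metric hgsym hinv] using
      hasDerivAt_tensor_geodesic hγC hgeo (fun i j => (hgC i j).differentiable_of_smooth) t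
  refine ⟨fun t => ?_, is_const_of_deriv_eq_zero (fun t => (energy t).differentiableAt)
    fun t => (energy t).deriv⟩
  have d1 : deriv (fun s => lam (γ s))
      = fun s => ∑ i, pd i lam (γ s) * deriv (fun u => γ u i) s :=
    funext fun s => (hasDerivAt_comp_pd hlamd hγC s).deriv
  have d2 : deriv (deriv (fun s => lam (γ s))) = fun s =>
      μ (γ s) * (∑ i, ∑ j, g (γ s) i j * deriv (fun u => γ u i) s * deriv (fun u => γ u j) s)
      + B * ∑ i, ∑ j, a (γ s) i j * deriv (fun u => γ u i) s * deriv (fun u => γ u j) s := by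
    funext s
    rw [d1, (hasDerivAt_covector_geodesic hγC hgeo (ω := fun x i => pd i lam x)
      (fun i => (contDiff_pd hlamC i).differentiable_of_smooth) s).deriv]
    have h : ∀ i j, covD1 g ginv (fun x i => pd i lam x) i j (γ s) = _ := hhess (γ s)
    simp only [h, Finset.mul_sum, ← Finset.sum_add_distrib]
    exact Finset.sum_congr rfl fun i _ => Finset.sum_congr rfl fun j _ => by ring
  have d_a := hasDerivAt_tensor_geodesic hγC hgeo
    (fun i j => (haC i j).differentiable_of_smooth) t
  have d_mu := hasDerivAt_comp_pd hμC.differentiable_of_smooth hγC t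
  rw [d2, ((d_mu.fun_mul (energy t)).fun_add (d_a.const_mul B)).deriv, d1]
  simp only [ha, pd_hessian_coefficient hn hgC hginvC haC hμC hlamC hgsym hinv hasym hlam ha hhess]
  set v : Fin n → ℝ := fun i => deriv (fun u => γ u i) t
  set c : ℝ := ∑ i, ∑ j, g (γ t) i j * v i * v j with hc
  have first : ∑ i, ∑ j, ∑ k, pd i lam (γ t) * g (γ t) j k * v i * v j * v k
      = (∑ i, pd i lam (γ t) * v i) * c := by
    rw [hc, Finset.sum_mul]
    simp only [Finset.mul_sum]
    exact Finset.sum_congr rfl fun i _ => Finset.sum_congr rfl fun j _ =>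
      Finset.sum_congr rfl fun k _ => by ring
  have second : ∑ i, ∑ j, ∑ k, pd j lam (γ t) * g (γ t) i k * v i * v j * v k
      = (∑ i, pd i lam (γ t) * v i) * c := by
    rw [← first, Finset.sum_comm]
    exact Finset.sum_congr rfl fun i _ => Finset.sum_congr rfl fun j _ =>
      Finset.sum_congr rfl fun k _ => by ring
  have cubic : ∑ i, ∑ j, ∑ k, (pd i lam (γ t) * g (γ t) j k + pd j lam (γ t) * g (γ t) i k)
      * v i * v j * v k = 2 * (∑ i, pd i lam (γ t) * v i) * c := by
    simp only [add_mul, Finset.sum_add_distrib]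
    rw [first, second]
    ring
  rw [cubic]
  simp only [mul_assoc (2 * B), ← Finset.mul_sum]
  ring
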